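/- arXiv:1408.1390 — 5 statements merged into one kernel-verified Lean document; each statement's English description precedes it below -/
import Mathlib

section
/- Let G = (V, E) be a finite connected undirected simple graph, and let Ĝ = (V, Ê) be the graph on the same vertex set in which {u, v} ∈ Ê if and only if u ≠ v and the shortest path between u and v in G is maximal. Then a set V' ⊆ V is a strongly resolving set for G if and only if V' is a vertex cover of Ĝ. -/
/-- `v` lies on some shortest path between `x` and `u`, or `u` lies on some shortest path
between `x` and `v` (expressed via distances in a connected graph):
node `x` strongly resolves the pair `{u, v}`. -/
def StronglyResolves {V : Type*} (G : SimpleGraph V) (x u v : V) : Prop :=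
  G.dist x v + G.dist v u = G.dist x u ∨ G.dist x u + G.dist u v = G.dist x v

/-- `S` is a strongly resolving set for `G`: every pair of distinct nodes is strongly
resolved by some node of `S`. -/
def IsStronglyResolvingSet {V : Type*} (G : SimpleGraph V) (S : Set V) : Prop :=
  ∀ u v : V, u ≠ v → ∃ x ∈ S, StronglyResolves G x u v

/-- The shortest path between `u` and `v` is maximal: every neighbor `x` of `u` satisfies
`d(x,v) ≤ d(u,v)` and every neighbor `y` of `v` satisfies `d(y,u) ≤ d(u,v)`. -/
def MaximalShortestPathPair {V : Type*} (G : SimpleGraph V) (u v : V) : Prop :=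
  (∀ x : V, G.Adj u x → G.dist x v ≤ G.dist u v) ∧
  (∀ y : V, G.Adj v y → G.dist y u ≤ G.dist u v)

/-- The graph `Ĝ` on the same vertex set, with `{u,v}` an edge iff `u ≠ v` and the shortest
path between `u` and `v` in `G` is maximal. -/
def hatGraph {V : Type*} (G : SimpleGraph V) : SimpleGraph V :=
  SimpleGraph.fromRel (MaximalShortestPathPair G)

/-- `C` is a vertex cover of `G`: it intersects every edge. -/
def IsVertexCover {V : Type*} (G : SimpleGraph V) (C : Set V) : Prop :=
  ∀ u v : V, G.Adj u v → u ∈ C ∨ v ∈ C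

namespace SimpleGraph

/-- The first step of a shortest path from `v` to `x` decreases the distance to `x`. -/
theorem Connected.exists_adj_dist_add_one_eq {V : Type*} {G : SimpleGraph V}
    (hG : G.Connected) {v x : V} (h : v ≠ x) :
    ∃ y, G.Adj v y ∧ G.dist y x + 1 = G.dist v x := by
  obtain ⟨p, hp⟩ := hG.exists_walk_length_eq_dist v x
  cases p with
  | nil => exact absurd rfl h
  | @cons _ y _ hadj q =>
    refine ⟨y, hadj, ?_⟩
    have h₁ := dist_le q
    have h₂ := hG.dist_triangle (u := v) (v := y) (w := x)
    rw [dist_eq_one_iff_adj.mpr hadj] at h₂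
    rw [Walk.length_cons] at hp
    omega

end SimpleGraph

theorem MaximalShortestPathPair.symm {V : Type*} {G : SimpleGraph V} {u v : V}
    (h : MaximalShortestPathPair G u v) : MaximalShortestPathPair G v u :=
  ⟨fun x hx => (h.2 x hx).trans_eq G.dist_comm, fun y hy => (h.1 y hy).trans_eq G.dist_comm⟩

theorem hatGraph_adj {V : Type*} {G : SimpleGraph V} {u v : V} :
    (hatGraph G).Adj u v ↔ u ≠ v ∧ MaximalShortestPathPair G u v := by
  rw [hatGraph, SimpleGraph.fromRel_adj]
  exact and_congr_right fun _ => ⟨fun h => h.elim id .symm, Or.inl⟩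

/-- A shortest path that cannot be extended beyond `v` ends at `v`. -/
theorem eq_of_dist_add_dist_eq {V : Type*} {G : SimpleGraph V} (hG : G.Connected) {u v x : V}
    (hmax : ∀ y, G.Adj v y → G.dist y u ≤ G.dist v u)
    (h : G.dist x v + G.dist v u = G.dist x u) : x = v := by
  by_contra hne
  obtain ⟨y, hadj, hy⟩ := hG.exists_adj_dist_add_one_eq (Ne.symm hne)
  have h₁ := hmax y hadj
  have h₂ := hG.dist_triangle (u := x) (v := y) (w := u)
  rw [G.dist_comm (u := y) (v := x), G.dist_comm (u := v) (v := x)] at hy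
  omega

theorem MaximalShortestPathPair.eq_or_eq_of_stronglyResolves {V : Type*} {G : SimpleGraph V}
    (hG : G.Connected) {u v x : V} (hmax : MaximalShortestPathPair G u v)
    (h : StronglyResolves G x u v) : x = u ∨ x = v :=
  h.elim (fun h => .inr (eq_of_dist_add_dist_eq hG hmax.symm.1 h))
    (fun h => .inl (eq_of_dist_add_dist_eq hG hmax.1 h))

/-- Every shortest path extends to a maximal one. -/
theorem exists_maximalShortestPathPair {V : Type*} [Finite V] {G : SimpleGraph V}
    (hG : G.Connected) (u v : V) :
    ∃ a b, MaximalShortestPathPair G a b ∧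
      G.dist a u + G.dist u v + G.dist v b = G.dist a b := by
  obtain ⟨⟨a, b⟩, hab, hmax⟩ := Set.exists_max_image
    {p : V × V | G.dist p.1 u + G.dist u v + G.dist v p.2 = G.dist p.1 p.2}
    (fun p => G.dist p.1 p.2) (Set.toFinite _) ⟨(u, v), by simp⟩
  simp only [Set.mem_ofPred_eq, Prod.forall] at hab hmax
  refine ⟨a, b, ⟨fun x hx => ?_, fun y hy => ?_⟩, hab⟩
  · by_contra! hlt
    have h₁ := hG.dist_triangle (u := x) (v := a) (w := u)
    have h₂ := hG.dist_triangle (u := x) (v := u) (w := b)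
    have h₃ := hG.dist_triangle (u := u) (v := v) (w := b)
    rw [SimpleGraph.dist_eq_one_iff_adj.mpr hx.symm] at h₁
    have := hmax x b
    omega
  · by_contra! hlt
    rw [G.dist_comm (u := y)] at hlt
    have h₁ := hG.dist_triangle (u := v) (v := b) (w := y)
    have h₂ := hG.dist_triangle (u := a) (v := u) (w := y)
    have h₃ := hG.dist_triangle (u := u) (v := v) (w := y)
    rw [SimpleGraph.dist_eq_one_iff_adj.mpr hy] at h₁
    have := hmax a y
    omega

theorem strongly_resolving_iff_vertex_cover_of_hatGraph
    {V : Type*} [Fintype V] (G : SimpleGraph V) (hG : G.Connected) (S : Set V) :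
    IsStronglyResolvingSet G S ↔ IsVertexCover (hatGraph G) S := by
  constructor
  · intro hS u v hadj
    obtain ⟨hne, hmax⟩ := hatGraph_adj.mp hadj
    obtain ⟨x, hx, hres⟩ := hS u v hne
    obtain rfl | rfl := hmax.eq_or_eq_of_stronglyResolves hG hres
    exacts [.inl hx, .inr hx]
  · intro hS u v hne
    obtain ⟨a, b, hmax, hab⟩ := exists_maximalShortestPathPair hG u v
    have hpos := hG.pos_dist_of_ne hne
    have hne' : a ≠ b := by
      rintro rfl
      rw [SimpleGraph.dist_self] at hab
      omega
    obtain ha | hb := hS a b (hatGraph_adj.mpr ⟨hne', hmax⟩)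
    · refine ⟨a, ha, .inr ?_⟩
      have h₁ := hG.dist_triangle (u := a) (v := u) (w := v)
      have h₂ := hG.dist_triangle (u := a) (v := v) (w := b)
      omega
    · refine ⟨b, hb, .inl ?_⟩
      have h₁ := hG.dist_triangle (u := u) (v := v) (w := b)
      have h₂ := hG.dist_triangle (u := a) (v := u) (w := b)
      rw [G.dist_comm (u := b) (v := v), G.dist_comm (u := b) (v := u),
        G.dist_comm (u := v) (v := u)]
      omega
end

section
/- Let G = (V, E) be a finite connected undirected simple graph and let u ≠ v be nodes of G such that the shortest path between u and v is maximal. If a node x strongly resolves the pair {u, v}, then x = u or x = v. -/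
/-- If no neighbor of `v` is farther from `u` than `v` is, then no shortest path ending at `u`
passes through `v` unless it starts there. -/
theorem eq_of_dist_add_dist_eq_of_forall_adj_dist_le {V : Type*} {G : SimpleGraph V}
    (hG : G.Connected) {u v x : V} (hv : ∀ y : V, G.Adj v y → G.dist y u ≤ G.dist v u)
    (hx : G.dist x v + G.dist v u = G.dist x u) : x = v := by
  obtain ⟨p, hp⟩ := hG.exists_walk_length_eq_dist v x
  cases p with
  | nil => rfl
  | @cons _ y _ hadj q =>
    have hq := SimpleGraph.dist_le q
    have htri := hG.dist_triangle (u := x) (v := y) (w := u)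
    have hy := hv y hadj
    rw [SimpleGraph.Walk.length_cons] at hp
    rw [G.dist_comm (u := x) (v := v)] at hx
    rw [G.dist_comm (u := x) (v := y)] at htri
    omega

theorem eq_of_stronglyResolves_maximal_pair
    {V : Type*} [Fintype V] (G : SimpleGraph V) (hG : G.Connected)
    (u v x : V) (huv : u ≠ v) (hmax : MaximalShortestPathPair G u v)
    (hx : StronglyResolves G x u v) : x = u ∨ x = v := by
  rcases hx with h | h
  · refine Or.inr (eq_of_dist_add_dist_eq_of_forall_adj_dist_le hG (fun y hy => ?_) h)
    rw [G.dist_comm (u := v) (v := u)]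
    exact hmax.2 y hy
  · exact Or.inl (eq_of_dist_add_dist_eq_of_forall_adj_dist_le hG hmax.1 h)
end

section
/- Let G = (V, E) be a finite connected undirected simple graph with at least two vertices, let κ be the number of vertices u of G for which there exists a vertex v ≠ u with Nbr_G(u) = Nbr_G(v), and let u_1, …, u_κ be an enumeration of these vertices. Let G̃ be the graph with vertex set V ∪ {x_1, …, x_κ, y} (new vertices x_1, …, x_κ, y) whose edges are: all pairs {u, v} with u, v ∈ V, u ≠ v and {u, v} ∉ E; the pairs {x_j, u_j} for 1 ≤ j ≤ κ; and the pairs {y, z} for every z ∈ V ∪ {x_1, …, x_κ}. Then sdim(G̃) = κ + MNC(G). -/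
/-- The strong metric dimension: minimum size of a strongly resolving set. -/
noncomputable def sdim {V : Type*} (G : SimpleGraph V) : ℕ :=
  sInf {k | ∃ S : Set V, IsStronglyResolvingSet G S ∧ S.ncard = k}

/-- The minimum size of a vertex cover. -/
noncomputable def MNC {V : Type*} (G : SimpleGraph V) : ℕ :=
  sInf {k | ∃ C : Set V, IsVertexCover G C ∧ C.ncard = k}

/-- The base relation for the graph `G̃`: among old vertices, the complement of `G`;
each new vertex `x_j` is joined to `u_j`; the new vertex `y` is joined to everything. -/
def tildeRel {V : Type*} (G : SimpleGraph V) {κ : ℕ} (u : Fin κ → V) :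
    (V ⊕ (Fin κ ⊕ Unit)) → (V ⊕ (Fin κ ⊕ Unit)) → Prop
  | Sum.inl a, Sum.inl b => ¬ G.Adj a b
  | Sum.inl a, Sum.inr (Sum.inl j) => a = u j
  | _, Sum.inr (Sum.inr _) => True
  | _, _ => False

/-- The graph `G̃` obtained from `G`: its vertices are `V ∪ {x_1, …, x_κ, y}`, its edges
are the non-edges of `G`, the pairs `{x_j, u_j}`, and the pairs `{y, z}` for every other
vertex `z`. -/
def tildeGraph {V : Type*} (G : SimpleGraph V) {κ : ℕ} (u : Fin κ → V) :
    SimpleGraph (V ⊕ (Fin κ ⊕ Unit)) :=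
  SimpleGraph.fromRel (tildeRel G u)

section UniversalVertex

variable {W : Type*} {H : SimpleGraph W} {y : W}

theorem SimpleGraph.connected_of_universal (hy : ∀ z, z ≠ y → H.Adj y z) : H.Connected := by
  have h : ∀ z, H.Reachable y z := fun z => by
    by_cases hz : z = y
    · rw [hz]
    · exact (hy z hz).reachable
  have : Nonempty W := ⟨y⟩
  exact ⟨fun a b => (h a).symm.trans (h b)⟩

theorem SimpleGraph.dist_le_two_of_universal (hy : ∀ z, z ≠ y → H.Adj y z) (a b : W) :
    H.dist a b ≤ 2 := by
  have h : ∀ z, H.dist y z ≤ 1 := fun z => by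
    by_cases hz : z = y
    · simp [hz]
    · exact (SimpleGraph.dist_eq_one_iff_adj.2 (hy z hz)).le
  have htri := (SimpleGraph.connected_of_universal hy).dist_triangle (u := a) (v := y) (w := b)
  have ha := h a
  have hb := h b
  rw [SimpleGraph.dist_comm] at ha
  omega

theorem SimpleGraph.Connected.two_le_dist (hH : H.Connected) {a b : W} (hab : a ≠ b)
    (h : ¬ H.Adj a b) : 2 ≤ H.dist a b := by
  have h0 := hH.pos_dist_of_ne hab
  have h1 : H.dist a b ≠ 1 := fun h1 => h (SimpleGraph.dist_eq_one_iff_adj.1 h1)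
  omega

theorem stronglyResolves_left (a b : W) : StronglyResolves H a a b := by
  right; simp

theorem StronglyResolves.symm {x a b : W} (h : StronglyResolves H x a b) :
    StronglyResolves H x b a := Or.symm h

theorem stronglyResolves_right (a b : W) : StronglyResolves H b a b :=
  (stronglyResolves_left b a).symm

theorem stronglyResolves_of_universal (hy : ∀ z, z ≠ y → H.Adj y z) {x a b : W}
    (hab : H.Adj a b) (hxb : H.Adj x b) (hne : x ≠ a) (hxa : ¬ H.Adj x a) :
    StronglyResolves H x a b := by
  left
  have h1 := SimpleGraph.dist_eq_one_iff_adj.2 hab.symm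
  have h2 := SimpleGraph.dist_eq_one_iff_adj.2 hxb
  have h3 := SimpleGraph.dist_le_two_of_universal hy x a
  have h4 := (SimpleGraph.connected_of_universal hy).two_le_dist hne hxa
  omega

theorem StronglyResolves.eq_or_eq_of_not_adj (hy : ∀ z, z ≠ y → H.Adj y z) {x a b : W}
    (h : StronglyResolves H x a b) (hne : a ≠ b) (hab : ¬ H.Adj a b) : x = a ∨ x = b := by
  by_contra! hx
  have hH := SimpleGraph.connected_of_universal hy
  have h1 := hH.two_le_dist hne hab
  have h2 := hH.pos_dist_of_ne hx.1
  have h3 := hH.pos_dist_of_ne hx.2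
  have h4 := SimpleGraph.dist_le_two_of_universal hy x a
  have h5 := SimpleGraph.dist_le_two_of_universal hy x b
  have h6 := H.dist_comm (u := a) (v := b)
  unfold StronglyResolves at h
  omega

theorem IsStronglyResolvingSet.mem_or_mem_of_not_adj (hy : ∀ z, z ≠ y → H.Adj y z) {S : Set W}
    (hS : IsStronglyResolvingSet H S) {a b : W} (hne : a ≠ b) (hab : ¬ H.Adj a b) :
    a ∈ S ∨ b ∈ S := by
  obtain ⟨x, hx, h⟩ := hS a b hne
  rcases h.eq_or_eq_of_not_adj hy hne hab with rfl | rfl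
  · exact Or.inl hx
  · exact Or.inr hx

end UniversalVertex

section TildeGraph

variable {V : Type*} {G : SimpleGraph V} {κ : ℕ} {u : Fin κ → V}

theorem tildeGraph_adj_inl_inl {a b : V} :
    (tildeGraph G u).Adj (Sum.inl a) (Sum.inl b) ↔ a ≠ b ∧ ¬ G.Adj a b := by
  simp [tildeGraph, tildeRel, G.adj_comm b a]

theorem tildeGraph_adj_inl_new {a : V} {j : Fin κ} :
    (tildeGraph G u).Adj (Sum.inl a) (Sum.inr (Sum.inl j)) ↔ a = u j := by
  simp [tildeGraph, tildeRel]

theorem tildeGraph_not_adj_new_new {i j : Fin κ} :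
    ¬ (tildeGraph G u).Adj (Sum.inr (Sum.inl i)) (Sum.inr (Sum.inl j)) := by
  simp [tildeGraph, tildeRel]

theorem tildeGraph_universal (z : V ⊕ (Fin κ ⊕ Unit)) (hz : z ≠ Sum.inr (Sum.inr ())) :
    (tildeGraph G u).Adj (Sum.inr (Sum.inr ())) z := by
  rcases z with a | j | ⟨⟩ <;> simp_all [tildeGraph, tildeRel]

theorem MNC_le_ncard {C : Set V} (hC : IsVertexCover G C) : MNC G ≤ C.ncard :=
  Nat.sInf_le ⟨C, hC, rfl⟩

theorem exists_isVertexCover_ncard_eq_MNC (G : SimpleGraph V) :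
    ∃ C : Set V, IsVertexCover G C ∧ C.ncard = MNC G :=
  Nat.sInf_mem (s := {k | ∃ C : Set V, IsVertexCover G C ∧ C.ncard = k})
    ⟨_, Set.univ, fun _ _ _ => Or.inl trivial, rfl⟩

/-- Adding all pendant vertices to a vertex cover of `G` gives a strongly resolving set. -/
theorem IsVertexCover.isStronglyResolvingSet_tildeGraph [Nontrivial V] (hG : G.Connected)
    (htwin : ∀ a b : V, b ≠ a → G.neighborSet a = G.neighborSet b → ∃ j, u j = a)
    {C : Set V} (hC : IsVertexCover G C) :
    IsStronglyResolvingSet (tildeGraph G u)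
      (Sum.inl '' C ∪ Set.range fun j => Sum.inr (Sum.inl j)) := by
  set S : Set (V ⊕ (Fin κ ⊕ Unit)) := Sum.inl '' C ∪ Set.range fun j => Sum.inr (Sum.inl j)
  have hx : ∀ j, (Sum.inr (Sum.inl j) : V ⊕ (Fin κ ⊕ Unit)) ∈ S := fun j => Or.inr ⟨j, rfl⟩
  have hc : ∀ c ∈ C, (Sum.inl c : V ⊕ (Fin κ ⊕ Unit)) ∈ S := fun c h => Or.inl ⟨c, h, rfl⟩
  have hy : ∀ a : V, ∃ x ∈ S,
      StronglyResolves (tildeGraph G u) x (Sum.inl a) (Sum.inr (Sum.inr ())) := by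
    intro a
    by_cases ha : a ∈ C
    · exact ⟨_, hc a ha, stronglyResolves_left _ _⟩
    · obtain ⟨c, hac⟩ := hG.preconnected.exists_adj_of_nontrivial a
      refine ⟨_, hc c ((hC a c hac).resolve_left ha),
        stronglyResolves_of_universal tildeGraph_universal
          (tildeGraph_universal _ (by simp)).symm (tildeGraph_universal _ (by simp)).symm
          (by simpa using hac.ne') fun h => (tildeGraph_adj_inl_inl.1 h).2 hac.symm⟩
  have hdiff : ∀ a b : V, a ∉ C → ¬ G.Adj a b → a ≠ b → (∃ c, G.Adj a c ∧ ¬ G.Adj b c) →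
      ∃ x ∈ S, StronglyResolves (tildeGraph G u) x (Sum.inl a) (Sum.inl b) := by
    rintro a b ha hab hne ⟨c, hac, hbc⟩
    refine ⟨_, hc c ((hC a c hac).resolve_left ha),
      stronglyResolves_of_universal tildeGraph_universal (tildeGraph_adj_inl_inl.2 ⟨hne, hab⟩)
        (tildeGraph_adj_inl_inl.2 ⟨?_, fun h => hbc h.symm⟩) (by simpa using hac.ne')
        fun h => (tildeGraph_adj_inl_inl.1 h).2 hac.symm⟩
    rintro rfl
    exact hab hac
  rintro (a | i | ⟨⟩) (b | j | ⟨⟩) hne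
  · by_cases ha : a ∈ C
    · exact ⟨_, hc a ha, stronglyResolves_left _ _⟩
    by_cases hb : b ∈ C
    · exact ⟨_, hc b hb, stronglyResolves_right _ _⟩
    have hab : ¬ G.Adj a b := fun h => (hC a b h).elim ha hb
    have hne' : a ≠ b := by simpa using hne
    by_cases hN : G.neighborSet a = G.neighborSet b
    · obtain ⟨j, rfl⟩ := htwin a b hne'.symm hN
      refine ⟨_, hx j, (stronglyResolves_of_universal tildeGraph_universal
        (tildeGraph_adj_inl_inl.2 ⟨hne'.symm, fun h => hab h.symm⟩)
        (tildeGraph_adj_inl_new.2 rfl).symm (by simp) fun h => ?_).symm⟩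
      exact hne' (tildeGraph_adj_inl_new.1 h.symm).symm
    · by_cases h : ∃ c, G.Adj a c ∧ ¬ G.Adj b c
      · exact hdiff a b ha hab hne' h
      · have h' : ∃ c, G.Adj b c ∧ ¬ G.Adj a c := by
          by_contra h'
          push Not at h h'
          exact hN (Set.ext fun c => ⟨h c, h' c⟩)
        obtain ⟨x, hxS, hr⟩ := hdiff b a hb (fun h => hab h.symm) hne'.symm h'
        exact ⟨x, hxS, hr.symm⟩
  · exact ⟨_, hx j, stronglyResolves_right _ _⟩
  · exact hy a
  · exact ⟨_, hx i, stronglyResolves_left _ _⟩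
  · exact ⟨_, hx i, stronglyResolves_left _ _⟩
  · exact ⟨_, hx i, stronglyResolves_left _ _⟩
  · obtain ⟨x, hxS, hr⟩ := hy b
    exact ⟨x, hxS, hr.symm⟩
  · exact ⟨_, hx j, stronglyResolves_right _ _⟩
  · exact absurd rfl hne

theorem IsStronglyResolvingSet.kappa_add_MNC_le_ncard [Finite V]
    (htwin : ∀ j, ∃ b : V, b ≠ u j ∧ G.neighborSet (u j) = G.neighborSet b)
    {S : Set (V ⊕ (Fin κ ⊕ Unit))} (hS : IsStronglyResolvingSet (tildeGraph G u) S) :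
    κ + MNC G ≤ S.ncard := by
  set A : Set V := Sum.inl ⁻¹' S
  set B : Set (Fin κ) := (fun j => Sum.inr (Sum.inl j)) ⁻¹' S
  have hAB : A.ncard + B.ncard ≤ S.ncard := by
    have hdisj : Disjoint (Sum.inl '' A : Set (V ⊕ (Fin κ ⊕ Unit)))
        ((fun j => Sum.inr (Sum.inl j)) '' B) := by
      rw [Set.disjoint_left]
      rintro _ ⟨a, -, rfl⟩ ⟨j, -, h⟩
      simp at h
    rw [← Set.ncard_image_of_injective A
        (Sum.inl_injective : Function.Injective (Sum.inl : V → V ⊕ (Fin κ ⊕ Unit))),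
      ← Set.ncard_image_of_injective B
        (f := fun j => (Sum.inr (Sum.inl j) : V ⊕ (Fin κ ⊕ Unit)))
        (Sum.inr_injective.comp Sum.inl_injective),
      ← Set.ncard_union_eq hdisj]
    refine Set.ncard_le_ncard (Set.union_subset ?_ ?_)
    · exact Set.image_preimage_subset _ _
    · exact Set.image_preimage_subset _ _
  have hmem := fun {a b : V ⊕ (Fin κ ⊕ Unit)} (hne : a ≠ b) h =>
    hS.mem_or_mem_of_not_adj tildeGraph_universal hne h
  by_cases hB : ∃ j, j ∉ B
  · obtain ⟨j, hj⟩ := hB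
    obtain ⟨b, hb, hN⟩ := htwin j
    have hBcard : κ ≤ B.ncard + 1 := by
      have hsub : Bᶜ ⊆ {j} := fun i hi => by
        by_contra hij
        exact (hmem (a := Sum.inr (Sum.inl i)) (b := Sum.inr (Sum.inl j)) (by simpa using hij)
          tildeGraph_not_adj_new_new).elim hi hj
      have h1 := Set.ncard_le_ncard hsub
      have h2 := Set.ncard_add_ncard_compl B
      rw [Set.ncard_singleton] at h1
      rw [Nat.card_fin] at h2
      omega
    have hA : ∀ a, a ≠ u j → a ∈ A := fun a ha =>
      (hmem (a := Sum.inl a) (b := Sum.inr (Sum.inl j)) (by simp)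
        fun h => ha (tildeGraph_adj_inl_new.1 h)).resolve_right hj
    have hnadj : ¬ G.Adj (u j) b := fun h => by
      have : b ∈ G.neighborSet b := hN ▸ h
      exact G.loopless.irrefl b this
    have hcover : IsVertexCover G (A \ {b}) := by
      intro c d hcd
      by_contra! h
      have key : ∀ c, c ∉ A \ {b} → c = u j ∨ c = b := fun c hc => by
        by_contra! h'
        exact hc ⟨hA c h'.1, h'.2⟩
      rcases key c h.1 with rfl | rfl <;> rcases key d h.2 with rfl | rfl
      · exact hcd.ne rfl
      · exact hnadj hcd
      · exact hnadj hcd.symm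
      · exact hcd.ne rfl
    have h1 := MNC_le_ncard hcover
    have h2 := Set.ncard_sdiff_singleton_add_one (hA b hb)
    omega
  · push Not at hB
    have hBcard : B.ncard = κ := by
      rw [Set.eq_univ_of_forall hB]; simp
    have hcover : IsVertexCover G A := fun c d hcd =>
      hmem (a := Sum.inl c) (b := Sum.inl d) (by simpa using hcd.ne)
        fun h => (tildeGraph_adj_inl_inl.1 h).2 hcd
    have := MNC_le_ncard hcover
    omega

end TildeGraph

theorem sdim_tildeGraph_eq_kappa_add_mnc {V : Type*} [Fintype V] [Nontrivial V]
    (G : SimpleGraph V) (hG : G.Connected) {κ : ℕ} (u : Fin κ → V)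
    (hinj : Function.Injective u)
    (hrange : Set.range u = {a : V | ∃ b : V, b ≠ a ∧ G.neighborSet a = G.neighborSet b}) :
    sdim (tildeGraph G u) = κ + MNC G := by
  apply le_antisymm
  · obtain ⟨C, hC, hcard⟩ := exists_isVertexCover_ncard_eq_MNC G
    have htwin : ∀ a b : V, b ≠ a → G.neighborSet a = G.neighborSet b → ∃ j, u j = a :=
      fun a b hne hN => hrange.symm.subset ⟨b, hne, hN⟩
    have hS := hC.isStronglyResolvingSet_tildeGraph hG htwin
    have hle : sdim (tildeGraph G u) ≤ _ := Nat.sInf_le ⟨_, hS, rfl⟩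
    refine hle.trans ?_
    refine (Set.ncard_union_le _ _).trans ?_
    rw [Set.ncard_image_of_injective _ Sum.inl_injective, hcard, ← Set.image_univ,
      Set.ncard_image_of_injective (f := fun j => (Sum.inr (Sum.inl j) : V ⊕ (Fin κ ⊕ Unit)))
        _ (Sum.inr_injective.comp Sum.inl_injective)]
    simp [add_comm]
  · refine le_csInf ⟨_, Set.univ, fun a b _ => ⟨a, trivial, stronglyResolves_left a b⟩, rfl⟩ ?_
    rintro _ ⟨S, hS, rfl⟩
    exact hS.kappa_add_MNC_le_ncard fun j => hrange.subset ⟨j, rfl⟩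
end

section
/- Let G = (V, E) be a finite connected undirected simple graph with at least two vertices in which no two distinct vertices have the same neighborhood (i.e., Nbr_G(u) = Nbr_G(v) implies u = v). Let G̃ be the graph with vertex set V ∪ {y} (y a new vertex) whose edges are all pairs {u, v} with u, v ∈ V, u ≠ v, {u, v} ∉ E, together with {y, z} for every z ∈ V. Then sdim(G̃) = MNC(G). -/
/-- The base relation for the graph `G̃` (twin-free case, no `x_j` vertices): among old
vertices, the complement of `G`; the new vertex `y` is joined to every old vertex. -/
def tildeRel0 {V : Type*} (G : SimpleGraph V) : (V ⊕ Unit) → (V ⊕ Unit) → Prop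
  | Sum.inl a, Sum.inl b => ¬ G.Adj a b
  | _, Sum.inr _ => True
  | _, _ => False

/-- The graph `G̃` in the twin-free case: vertices `V ∪ {y}`, edges the non-edges of `G`
together with `{y, z}` for every `z ∈ V`. -/
def tildeGraph0 {V : Type*} (G : SimpleGraph V) : SimpleGraph (V ⊕ Unit) :=
  SimpleGraph.fromRel (tildeRel0 G)

section Adjacency

variable {V : Type*} {G : SimpleGraph V}

theorem tildeGraph0_adj_inl_inl {a b : V} :
    (tildeGraph0 G).Adj (Sum.inl a) (Sum.inl b) ↔ a ≠ b ∧ ¬ G.Adj a b := by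
  simp [tildeGraph0, SimpleGraph.fromRel_adj, tildeRel0, G.adj_comm b a]

theorem tildeGraph0_adj_inl_inr (a : V) (y : Unit) :
    (tildeGraph0 G).Adj (Sum.inl a) (Sum.inr y) := by
  simp [tildeGraph0, SimpleGraph.fromRel_adj, tildeRel0]

theorem tildeGraph0_dist_inl_inr (a : V) (y : Unit) :
    (tildeGraph0 G).dist (Sum.inl a) (Sum.inr y) = 1 :=
  SimpleGraph.dist_eq_one_iff_adj.2 (tildeGraph0_adj_inl_inr a y)

theorem tildeGraph0_dist_inr_inl (y : Unit) (a : V) :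
    (tildeGraph0 G).dist (Sum.inr y) (Sum.inl a) = 1 :=
  SimpleGraph.dist_eq_one_iff_adj.2 (tildeGraph0_adj_inl_inr a y).symm

theorem tildeGraph0_dist_of_not_adj {a b : V} (hne : a ≠ b) (h : ¬ G.Adj a b) :
    (tildeGraph0 G).dist (Sum.inl a) (Sum.inl b) = 1 :=
  SimpleGraph.dist_eq_one_iff_adj.2 (tildeGraph0_adj_inl_inl.2 ⟨hne, h⟩)

theorem tildeGraph0_dist_inl_inl_le_two (a b : V) :
    (tildeGraph0 G).dist (Sum.inl a) (Sum.inl b) ≤ 2 :=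
  SimpleGraph.dist_le (.cons (tildeGraph0_adj_inl_inr a ())
    (.cons (tildeGraph0_adj_inl_inr b ()).symm .nil))

theorem tildeGraph0_dist_of_adj {a b : V} (h : G.Adj a b) :
    (tildeGraph0 G).dist (Sum.inl a) (Sum.inl b) = 2 := by
  have hle := tildeGraph0_dist_inl_inl_le_two (G := G) a b
  have hreach : (tildeGraph0 G).Reachable (Sum.inl a) (Sum.inl b) :=
    (tildeGraph0_adj_inl_inr a ()).reachable.trans (tildeGraph0_adj_inl_inr b ()).symm.reachable
  have hpos := hreach.pos_dist_of_ne (by simpa using h.ne)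
  have hone : (tildeGraph0 G).dist (Sum.inl a) (Sum.inl b) ≠ 1 := fun h1 =>
    (tildeGraph0_adj_inl_inl.1 (SimpleGraph.dist_eq_one_iff_adj.1 h1)).2 h
  omega

theorem tildeGraph0_eq_of_dist_add_two_eq {x : V ⊕ Unit} {a b : V}
    (h : (tildeGraph0 G).dist x (Sum.inl a) + 2 = (tildeGraph0 G).dist x (Sum.inl b)) :
    x = Sum.inl a := by
  rcases x with c | y
  · have hle := tildeGraph0_dist_inl_inl_le_two (G := G) c b
    by_contra hne
    by_cases hca : G.Adj c a
    · rw [tildeGraph0_dist_of_adj hca] at h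
      omega
    · rw [tildeGraph0_dist_of_not_adj (fun e => hne (congrArg _ e)) hca] at h
      omega
  · simp [tildeGraph0_dist_inr_inl] at h

theorem eq_or_eq_of_stronglyResolves_tildeGraph0 {x : V ⊕ Unit} {a b : V} (hab : G.Adj a b)
    (h : StronglyResolves (tildeGraph0 G) x (Sum.inl a) (Sum.inl b)) :
    x = Sum.inl a ∨ x = Sum.inl b := by
  rw [StronglyResolves, tildeGraph0_dist_of_adj hab, tildeGraph0_dist_of_adj hab.symm] at h
  exact h.symm.imp tildeGraph0_eq_of_dist_add_two_eq tildeGraph0_eq_of_dist_add_two_eq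

theorem stronglyResolves_comm {H : SimpleGraph V} {x u v : V} :
    StronglyResolves H x u v ↔ StronglyResolves H x v u :=
  or_comm

theorem stronglyResolves_self (H : SimpleGraph V) (u v : V) : StronglyResolves H u u v := by
  simp [StronglyResolves]

theorem IsStronglyResolvingSet.isVertexCover_preimage_inl {S : Set (V ⊕ Unit)}
    (hS : IsStronglyResolvingSet (tildeGraph0 G) S) : IsVertexCover G (Sum.inl ⁻¹' S) := by
  intro a b hab
  obtain ⟨x, hx, hres⟩ := hS (Sum.inl a) (Sum.inl b) (by simpa using hab.ne)
  rcases eq_or_eq_of_stronglyResolves_tildeGraph0 hab hres with rfl | rfl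
  · exact Or.inl hx
  · exact Or.inr hx

theorem IsVertexCover.exists_stronglyResolves_of_adj {C : Set V} (hC : IsVertexCover G C)
    {u w : V} {p : V ⊕ Unit} (hwu : G.Adj w u)
    (hwp : (tildeGraph0 G).dist (Sum.inl w) p = 1) (hpu : (tildeGraph0 G).dist p (Sum.inl u) = 1) :
    ∃ x ∈ Sum.inl '' C, StronglyResolves (tildeGraph0 G) x (Sum.inl u) p := by
  rcases hC w u hwu with hw | hu
  · refine ⟨_, Set.mem_image_of_mem _ hw, Or.inl ?_⟩
    rw [hwp, hpu, tildeGraph0_dist_of_adj hwu]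
  · exact ⟨_, Set.mem_image_of_mem _ hu, stronglyResolves_self _ _ _⟩

theorem IsVertexCover.exists_stronglyResolves_of_neighborSet_not_subset {C : Set V}
    (hC : IsVertexCover G C) {a b : V} (hne : a ≠ b) (hab : ¬ G.Adj a b)
    (h : ¬ G.neighborSet a ⊆ G.neighborSet b) :
    ∃ x ∈ Sum.inl '' C, StronglyResolves (tildeGraph0 G) x (Sum.inl a) (Sum.inl b) := by
  obtain ⟨w, hwa, hwb⟩ := Set.not_subset.1 h
  rw [SimpleGraph.mem_neighborSet] at hwa hwb
  refine hC.exists_stronglyResolves_of_adj hwa.symm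
    (tildeGraph0_dist_of_not_adj ?_ fun e => hwb e.symm)
    (tildeGraph0_dist_of_not_adj hne.symm fun e => hab e.symm)
  rintro rfl
  exact hab hwa

theorem IsVertexCover.isStronglyResolvingSet_image_inl {C : Set V} (hC : IsVertexCover G C)
    (hdeg : ∀ a, ∃ w, G.Adj a w)
    (htwinfree : ∀ a b : V, G.neighborSet a = G.neighborSet b → a = b) :
    IsStronglyResolvingSet (tildeGraph0 G) (Sum.inl '' C) := by
  have hy (a : V) (y : Unit) :
      ∃ x ∈ Sum.inl '' C, StronglyResolves (tildeGraph0 G) x (Sum.inl a) (Sum.inr y) := by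
    obtain ⟨w, hw⟩ := hdeg a
    exact hC.exists_stronglyResolves_of_adj hw.symm (tildeGraph0_dist_inl_inr w y)
      (tildeGraph0_dist_inr_inl y a)
  rintro (a | y) (b | z) hne
  · replace hne : a ≠ b := fun e => hne (congrArg _ e)
    by_cases hab : G.Adj a b
    · rcases hC a b hab with ha | hb
      · exact ⟨_, Set.mem_image_of_mem _ ha, stronglyResolves_self _ _ _⟩
      · exact ⟨_, Set.mem_image_of_mem _ hb, stronglyResolves_comm.1 (stronglyResolves_self _ _ _)⟩
    · by_cases hsub : G.neighborSet a ⊆ G.neighborSet b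
      · obtain ⟨x, hx, hres⟩ := hC.exists_stronglyResolves_of_neighborSet_not_subset hne.symm
          (fun e => hab e.symm) fun hsub' => hne (htwinfree a b (hsub.antisymm hsub'))
        exact ⟨x, hx, stronglyResolves_comm.1 hres⟩
      · exact hC.exists_stronglyResolves_of_neighborSet_not_subset hne hab hsub
  · exact hy a z
  · obtain ⟨x, hx, hres⟩ := hy b y
    exact ⟨x, hx, stronglyResolves_comm.1 hres⟩
  · exact absurd rfl hne

end Adjacency

theorem sdim_tildeGraph0_eq_mnc {V : Type*} [Fintype V] [Nontrivial V]
    (G : SimpleGraph V) (hG : G.Connected)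
    (htwinfree : ∀ a b : V, G.neighborSet a = G.neighborSet b → a = b) :
    sdim (tildeGraph0 G) = MNC G := by
  have hdeg (a : V) : ∃ w, G.Adj a w := hG.preconnected.exists_adj_of_nontrivial a
  apply le_antisymm
  · obtain ⟨C, hC, hcard⟩ : MNC G ∈ {k | ∃ C : Set V, IsVertexCover G C ∧ C.ncard = k} :=
      Nat.sInf_mem ⟨_, Set.univ, fun _ _ _ => Or.inl trivial, rfl⟩
    rw [← hcard, ← Set.ncard_image_of_injective C (Sum.inl_injective (β := Unit))]
    exact Nat.sInf_le ⟨_, hC.isStronglyResolvingSet_image_inl hdeg htwinfree, rfl⟩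
  · obtain ⟨S, hS, hcard⟩ : sdim (tildeGraph0 G) ∈
        {k | ∃ S, IsStronglyResolvingSet (tildeGraph0 G) S ∧ S.ncard = k} :=
      Nat.sInf_mem ⟨_, Set.univ, fun u v _ => ⟨u, trivial, stronglyResolves_self _ u v⟩, rfl⟩
    rw [← hcard]
    calc MNC G ≤ (Sum.inl ⁻¹' S : Set V).ncard :=
          Nat.sInf_le ⟨_, hS.isVertexCover_preimage_inl, rfl⟩
      _ = (Sum.inl '' (Sum.inl ⁻¹' S : Set V) : Set (V ⊕ Unit)).ncard :=
          (Set.ncard_image_of_injective _ Sum.inl_injective).symm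
      _ ≤ S.ncard := Set.ncard_le_ncard (Set.image_preimage_subset _ _) S.toFinite
end

section
/- Let G be a connected graph with vertex set {u_1, …, u_n}, n ≥ 2, let k = 1 + ⌊log₂ n⌋, and let G⁺ be the graph obtained from G by adding new vertices v_0, …, v_{k−1}, y and the edges {u_j, v_ℓ} for every 1 ≤ j ≤ n and 0 ≤ ℓ ≤ k−1 with b_ℓ(j) = 1, together with the edges {y, v_ℓ} for every 0 ≤ ℓ ≤ k−1. Then no two distinct vertices of G⁺ have the same neighborhood in G⁺; that is, G⁺ is twin-free. -/
/-- The base relation for the graph `G⁺` built from a graph `G` on vertices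
`u_1, …, u_n` (vertex `u_j` is `Sum.inl ⟨j-1⟩`): the edges of `G`; an edge `{u_j, v_ℓ}`
whenever the `ℓ`-th bit of the `k`-bit binary representation of `j` is `1`
(`v_ℓ` is `Sum.inr (Sum.inl ℓ)`); and the edges `{y, v_ℓ}` (`y` is `Sum.inr (Sum.inr ())`). -/
def plusRel {n k : ℕ} (G : SimpleGraph (Fin n)) :
    (Fin n ⊕ (Fin k ⊕ Unit)) → (Fin n ⊕ (Fin k ⊕ Unit)) → Prop
  | Sum.inl i, Sum.inl j => G.Adj i j
  | Sum.inl i, Sum.inr (Sum.inl l) => Nat.testBit (i.val + 1) l.val = true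
  | Sum.inr (Sum.inr _), Sum.inr (Sum.inl _) => True
  | _, _ => False

/-- The graph `G⁺` obtained from `G` by adding the new vertices `v_0, …, v_{k-1}, y`,
the edges `{u_j, v_ℓ}` for `b_ℓ(j) = 1`, and the edges `{y, v_ℓ}`. -/
def plusGraph {n k : ℕ} (G : SimpleGraph (Fin n)) : SimpleGraph (Fin n ⊕ (Fin k ⊕ Unit)) :=
  SimpleGraph.fromRel (plusRel G)

section Adjacency

variable {n k : ℕ} (G : SimpleGraph (Fin n))

lemma plusGraph_adj_inl_inl (i j : Fin n) :
    (plusGraph (k := k) G).Adj (Sum.inl i) (Sum.inl j) ↔ G.Adj i j := by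
  simp only [plusGraph, SimpleGraph.fromRel_adj, plusRel, ne_eq, Sum.inl.injEq, G.adj_comm j i,
    or_self]
  exact ⟨And.right, fun h => ⟨h.ne, h⟩⟩

lemma plusGraph_adj_inl_bit (i : Fin n) (l : Fin k) :
    (plusGraph (k := k) G).Adj (Sum.inl i) (Sum.inr (Sum.inl l)) ↔
      Nat.testBit (i.val + 1) l.val = true := by
  simp [plusGraph, plusRel]

lemma plusGraph_not_adj_inl_apex (i : Fin n) (t : Unit) :
    ¬ (plusGraph (k := k) G).Adj (Sum.inl i) (Sum.inr (Sum.inr t)) := by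
  simp [plusGraph, plusRel]

lemma plusGraph_adj_bit_apex (l : Fin k) (t : Unit) :
    (plusGraph (k := k) G).Adj (Sum.inr (Sum.inl l)) (Sum.inr (Sum.inr t)) := by
  simp [plusGraph, plusRel]

end Adjacency

theorem plusGraph_twin_free
    {n : ℕ} (hn : 2 ≤ n) (G : SimpleGraph (Fin n)) (hG : G.Connected)
    (k : ℕ) (hk : k = 1 + Nat.log 2 n) :
    ∀ a b : Fin n ⊕ (Fin k ⊕ Unit),
      (plusGraph (k := k) G).neighborSet a = (plusGraph (k := k) G).neighborSet b → a = b := by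
  have key (a b) (h : (plusGraph (k := k) G).neighborSet a = (plusGraph (k := k) G).neighborSet b)
      (x) : (plusGraph (k := k) G).Adj a x ↔ (plusGraph (k := k) G).Adj b x := Set.ext_iff.mp h x
  have : Nontrivial (Fin n) := Fin.nontrivial_iff_two_le.mpr hn
  have inl_ne_apex (i : Fin n) (t : Unit)
      (h : ∀ x, (plusGraph (k := k) G).Adj (Sum.inl i) x ↔
        (plusGraph (k := k) G).Adj (Sum.inr (Sum.inr t)) x) : False := by
    obtain ⟨m, hm⟩ := hG.preconnected.exists_adj_of_nontrivial i
    exact plusGraph_not_adj_inl_apex G m t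
      ((h (Sum.inl m)).mp ((plusGraph_adj_inl_inl G i m).mpr hm)).symm
  rintro (i | l | ⟨⟩) (j | m | ⟨⟩) h <;> replace h := key _ _ h
  · have hlt (i : Fin n) : i.val + 1 < 2 ^ k := by
      rw [hk, add_comm 1 (Nat.log 2 n)]
      exact (Nat.succ_le_of_lt i.isLt).trans_lt (Nat.lt_pow_succ_log_self one_lt_two n)
    have hij : i.val + 1 = j.val + 1 := by
      refine Nat.eq_of_testBit_eq fun l => ?_
      by_cases hl : l < k
      · have := h (Sum.inr (Sum.inl ⟨l, hl⟩))
        rw [plusGraph_adj_inl_bit, plusGraph_adj_inl_bit] at this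
        exact Bool.eq_iff_iff.mpr this
      · have hp : 2 ^ k ≤ 2 ^ l := Nat.pow_le_pow_right two_pos (not_lt.mp hl)
        rw [Nat.testBit_lt_two_pow ((hlt i).trans_le hp),
          Nat.testBit_lt_two_pow ((hlt j).trans_le hp)]
    exact congrArg Sum.inl (Fin.ext (Nat.succ_injective hij))
  · exact (plusGraph_not_adj_inl_apex G i () ((h _).mpr (plusGraph_adj_bit_apex G m ()))).elim
  · exact (inl_ne_apex i () h).elim
  · exact (plusGraph_not_adj_inl_apex G j () ((h _).mp (plusGraph_adj_bit_apex G l ()))).elim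
  · have hl : 2 ^ l.val ≤ n :=
      Nat.pow_le_of_le_log (by omega) (by have := l.isLt; omega)
    have hpos : 0 < 2 ^ l.val := Nat.two_pow_pos _
    have hadj := h (Sum.inl ⟨2 ^ l.val - 1, by omega⟩)
    rw [SimpleGraph.adj_comm, plusGraph_adj_inl_bit, SimpleGraph.adj_comm,
      plusGraph_adj_inl_bit] at hadj
    simp only [Nat.sub_add_cancel hpos, Nat.testBit_two_pow, decide_eq_true_eq, true_iff] at hadj
    exact congrArg (Sum.inr ∘ Sum.inl) (Fin.ext hadj)
  · exact ((plusGraph (k := k) G).loopless.irrefl _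
      ((h _).mp (plusGraph_adj_bit_apex G l ()))).elim
  · exact (inl_ne_apex j () fun x => (h x).symm).elim
  · exact ((plusGraph (k := k) G).loopless.irrefl _
      ((h _).mpr (plusGraph_adj_bit_apex G m ()))).elim
  · rfl
end
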